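/- Let p be an odd prime. The map φ: K_Q(p)^{⊗n}_{(p)} → H(ℤ_p)^{⊗n}, defined component-wise using the projection P (resp. R for diagonal elements), restricts to a group homomorphism on every p-torsion abelian subgroup: for all p-torsion M, M' ∈ K_Q(p)^{⊗n} with [M,M'] = 𝟙, one has φ(MM') = φ(M)φ(M'). -/

import Mathlib

noncomputable section

open Matrix

/-- The generalised Pauli shift operator `X` on `ℂ^p`, with `X |q⟩ = |q+1⟩`. -/
def Xmat (p : ℕ) [NeZero p] : Matrix (ZMod p) (ZMod p) ℂ :=
  Matrix.of fun i j => if i = j + 1 then 1 else 0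

/-- The primitive `p`-th root of unity `ω = exp(2πi/p)`. -/
def ωp (p : ℕ) : ℂ := Complex.exp (2 * Real.pi * Complex.I / p)

/-- The polynomial-exponential form
`ξ(q) = ∏_{k=1}^{m} exp((2πi/p^k) · Σ_{a=0}^{p-1} ϑ_{k,a} q^a)` with `ϑ_{k,a} ∈ ℤ_p`. -/
def expForm (p m : ℕ) [NeZero p] (ϑ : Fin m → ZMod p → ZMod p) (q : ZMod p) : ℂ :=
  ∏ k : Fin m, Complex.exp (2 * Real.pi * Complex.I / (p ^ (k.val + 1)) *
    ∑ a : ZMod p, ((ϑ k a).val : ℂ) * ((q.val : ℂ) ^ a.val))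

/-- The `n`-fold Kronecker product of `p × p` matrices, as a matrix indexed by `ℤ_p^n`. -/
def kron (p n : ℕ) [NeZero p] (Ms : Fin n → Matrix (ZMod p) (ZMod p) ℂ) :
    Matrix (Fin n → ZMod p) (Fin n → ZMod p) ℂ :=
  Matrix.of fun f g => ∏ i, Ms i (f i) (g i)

/-- The coefficient `ϑ_{j+1, a}` in the unique polynomial-exponential expansion of `ξ`
(and `0` if `ξ` has no such expansion or `j ≥ m`). -/
noncomputable def coeff (p m : ℕ) [NeZero p] (ξ : ZMod p → ℂ) (j : ℕ) (a : ZMod p) : ZMod p :=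
  if h : ∃ ϑ : Fin m → ZMod p → ZMod p, ∀ q, ξ q = expForm p m ϑ q then
    if hj : j < m then h.choose ⟨j, hj⟩ a else 0
  else 0

/-- The map `P`: `P(ξ)(q) = ω^{ϑ_{1,0} + ϑ_{1,1} q}`. -/
noncomputable def Pphi (p m : ℕ) [NeZero p] (ξ : ZMod p → ℂ) (q : ZMod p) : ℂ :=
  ωp p ^ ((coeff p m ξ 0 0).val + (coeff p m ξ 0 1).val * q.val)

/-- The map `R`: `R(ξ)(q) = ω^{ϑ_{1,0} + ϑ_{1,1} q} · (ω^{1/p})^{ϑ_{2,0}}`. -/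
noncomputable def Rphi (p m : ℕ) [NeZero p] (ξ : ZMod p → ℂ) (q : ZMod p) : ℂ :=
  Pphi p m ξ q *
    Complex.exp (2 * Real.pi * Complex.I / (p ^ 2) * ((coeff p m ξ 1 0).val : ℂ))

open Classical in
/-- The component map `φ₁ : K_{(p)} → H(ℤ_p)`: it sends a diagonal element `S_ξ` to
`S_{R(ξ)}`, sends `S_ξ X` to `S_{P(ξ)} X`, and for `S_ξ X^b` with `b ∉ {0, 1}` it is
defined by `φ₁(M) = φ₁(M^{b⁻¹})^b`. -/
noncomputable def phi1 (p m : ℕ) [NeZero p] (M : Matrix (ZMod p) (ZMod p) ℂ) :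
    Matrix (ZMod p) (ZMod p) ℂ :=
  if h : ∃ b : ZMod p, b ≠ 0 ∧ ∃ ξ : ZMod p → ℂ, M = Matrix.diagonal ξ * Xmat p ^ b.val then
    (Matrix.diagonal
        (Pphi p m (fun q => (M ^ ((h.choose⁻¹ : ZMod p)).val) q (q - 1))) * Xmat p)
      ^ h.choose.val
  else
    Matrix.diagonal (Rphi p m (fun q => M q q))

def En (p k N : ℕ) : ℂ := Complex.exp (2 * Real.pi * Complex.I / (p ^ (k + 1)) * (N : ℂ))

def nv (p : ℕ) [NeZero p] (g : ZMod p → ZMod p) (q : ZMod p) : ℕ :=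
  ∑ a : ZMod p, (g a).val * q.val ^ a.val

def ev (p : ℕ) [NeZero p] (g : ZMod p → ZMod p) (q : ZMod p) : ZMod p :=
  ∑ a : ZMod p, g a * q ^ a.val

def expN (p M : ℕ) [NeZero p] (ϑ : ℕ → ZMod p → ZMod p) (q : ZMod p) : ℂ :=
  ∏ k ∈ Finset.range M, En p k (nv p (ϑ k) q)

def Good (p m : ℕ) (ξ : ZMod p → ℂ) : Prop := ∀ q, ξ q ^ p ^ m = 1

section lemmas
set_option linter.unusedSectionVars false
variable {p : ℕ} [NeZero p]

lemma En_add (k a b : ℕ) : En p k (a + b) = En p k a * En p k b := by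
  unfold En; rw [← Complex.exp_add]; congr 1; push_cast; ring

lemma En_ne (k a : ℕ) : En p k a ≠ 0 := Complex.exp_ne_zero _

lemma En_zero (N : ℕ) : En p 0 N = ZMod.stdAddChar (N : ZMod p) := by
  have := ZMod.stdAddChar_coe (N := p) (N : ℤ)
  push_cast at this
  rw [this]; unfold En; congr 1; simp; ring

lemma En_succ_mul (k N : ℕ) : En p (k+1) (p * N) = En p k N := by
  have hp : (p : ℂ) ≠ 0 := by exact_mod_cast NeZero.ne p
  unfold En; congr 1; push_cast; field_simp; ring

lemma En_pow (k N r : ℕ) : En p k N ^ r = En p k (r * N) := by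
  unfold En; rw [← Complex.exp_nat_mul]; congr 1; push_cast; ring

lemma En_pow_k (k N : ℕ) : En p k N ^ p ^ k = ZMod.stdAddChar (N : ZMod p) := by
  rw [En_pow]
  induction k with
  | zero => simp [En_zero]
  | succ k ih => rw [pow_succ', mul_assoc, En_succ_mul, ih]

lemma psi_pow (x : ZMod p) : (ZMod.stdAddChar x : ℂ) ^ p = 1 := by
  rw [← AddChar.map_nsmul_eq_pow]; simp

lemma En_pow_lt (k N m : ℕ) (h : k < m) : En p k N ^ p ^ m = 1 := by
  obtain ⟨d, rfl⟩ := Nat.exists_eq_add_of_lt h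
  rw [show k + d + 1 = k + (1 + d) by ring, pow_add, pow_add, pow_mul, En_pow_k, pow_mul, pow_one,
    psi_pow, one_pow]

lemma nv_cast (g : ZMod p → ZMod p) (q : ZMod p) : ((nv p g q : ℕ) : ZMod p) = ev p g q := by
  simp [nv, ev]

lemma nv_zero (q : ZMod p) : nv p 0 q = 0 := by simp [nv]

lemma En_zero' (k : ℕ) : En p k 0 = 1 := by simp [En]

lemma ev_add (g h : ZMod p → ZMod p) (q : ZMod p) : ev p (g + h) q = ev p g q + ev p h q := by
  simp [ev, add_mul, Finset.sum_add_distrib]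

lemma ev_single (a c q : ZMod p) : ev p (Pi.single a c) q = c * q ^ a.val := by
  unfold ev
  rw [Finset.sum_eq_single a]
  · simp
  · intro b _ hb; simp [hb]
  · simp

lemma psi_inj {x y : ZMod p} (h : (ZMod.stdAddChar x : ℂ) = ZMod.stdAddChar y) : x = y :=
  ZMod.injective_stdAddChar h

variable [hp : Fact p.Prime]

lemma ev_inj : Function.Injective (ev p) := by
  intro g h hgh
  let P : Polynomial (ZMod p) := ∑ a : ZMod p, Polynomial.C (g a - h a) * Polynomial.X ^ a.val
  have hP : P = 0 := by
    apply Polynomial.eq_zero_of_natDegree_lt_card_of_eval_eq_zero' P Finset.univ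
    · intro q _
      have := congrFun hgh q
      simp only [ev] at this
      simp only [P, Polynomial.eval_finsetSum, Polynomial.eval_mul, Polynomial.eval_C,
        Polynomial.eval_pow, Polynomial.eval_X, sub_mul, Finset.sum_sub_distrib, this, sub_self]
    · rw [Finset.card_univ, ZMod.card]
      refine lt_of_le_of_lt (Polynomial.natDegree_sum_le_of_forall_le (n := p - 1) _ _ ?_) (Nat.sub_lt hp.out.pos one_pos)
      intro a _
      refine (Polynomial.natDegree_C_mul_X_pow_le _ _).trans ?_
      have := ZMod.val_lt a
      omega
  funext a
  have := congrArg (fun Q => Polynomial.coeff Q a.val) hP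
  simp only [P, Polynomial.finsetSum_coeff, Polynomial.coeff_C_mul_X_pow, Polynomial.coeff_zero] at this
  rw [Finset.sum_eq_single a] at this
  · simpa [sub_eq_zero] using this
  · intro b _ hb
    rw [if_neg]
    intro h; exact hb (ZMod.val_injective p h.symm)
  · simp

lemma ev_surj (f : ZMod p → ZMod p) : ∃ g, ev p g = f :=
  (Finite.injective_iff_surjective.mp (ev_inj (p := p))) f

lemma ev_inj' {g h : ZMod p → ZMod p} (hh : ∀ q, ev p g q = ev p h q) : g = h :=
  ev_inj (funext hh)

lemma expN_succ (M : ℕ) (ϑ : ℕ → ZMod p → ZMod p) (q : ZMod p) :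
    expN p (M+1) ϑ q = expN p M ϑ q * En p M (nv p (ϑ M) q) := by
  simp [expN, Finset.prod_range_succ]

lemma expN_good (M : ℕ) (ϑ : ℕ → ZMod p → ZMod p) : Good p M (expN p M ϑ) := by
  intro q
  rw [expN, ← Finset.prod_pow]
  apply Finset.prod_eq_one
  intro k hk
  exact En_pow_lt _ _ _ (Finset.mem_range.mp hk)

lemma expN_uniq (M : ℕ) (ϑ ϑ' : ℕ → ZMod p → ZMod p) (h : ∀ q, expN p M ϑ q = expN p M ϑ' q) :
    ∀ j < M, ϑ j = ϑ' j := by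
  induction M with
  | zero => intro j hj; omega
  | succ M ih =>
    have h1 : ϑ M = ϑ' M := by
      apply ev_inj'
      intro q
      have := congrArg (· ^ p ^ M) (h q)
      simp only [expN_succ, mul_pow] at this
      rw [expN_good, expN_good, one_mul, one_mul, En_pow_k, En_pow_k, nv_cast, nv_cast] at this
      exact psi_inj this
    have h2 : ∀ q, expN p M ϑ q = expN p M ϑ' q := by
      intro q
      have := h q
      rw [expN_succ, expN_succ, h1] at this
      exact mul_right_cancel₀ (En_ne _ _) this
    intro j hj
    rcases Nat.lt_succ_iff_lt_or_eq.mp hj with hj | rfl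
    · exact ih h2 j hj
    · exact h1

lemma exists_En (m : ℕ) (z : ℂ) (hz : z ^ p ^ (m+1) = 1) : ∃ e : ℕ, z = En p m e := by
  have hpr := Complex.isPrimitiveRoot_exp (p ^ (m+1)) (pow_ne_zero _ (NeZero.ne p))
  obtain ⟨i, _, hi⟩ := hpr.eq_pow_of_pow_eq_one hz
  refine ⟨i, ?_⟩
  rw [← hi, ← Complex.exp_nat_mul]
  unfold En; congr 1; push_cast; ring

lemma exists_psi (z : ℂ) (hz : z ^ p = 1) : ∃ e : ZMod p, z = ZMod.stdAddChar e := by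
  obtain ⟨e, he⟩ := exists_En (p := p) 0 z (by simpa using hz)
  exact ⟨e, by rw [he, En_zero]⟩

lemma Good.ne {m : ℕ} {ξ : ZMod p → ℂ} (h : Good p m ξ) (q : ZMod p) : ξ q ≠ 0 := by
  intro h0
  have := h q
  rw [h0, zero_pow (pow_ne_zero _ (NeZero.ne p))] at this
  exact zero_ne_one this

lemma Good.mul {m : ℕ} {ξ η : ZMod p → ℂ} (h : Good p m ξ) (h' : Good p m η) :
    Good p m (fun q => ξ q * η q) := by
  intro q; simp only; rw [mul_pow, h, h', one_mul]

lemma exists_exp (m : ℕ) (ξ : ZMod p → ℂ) (h : Good p m ξ) :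
    ∃ ϑ : ℕ → ZMod p → ZMod p, (∀ q, ξ q = expN p m ϑ q) ∧ ∀ k, m ≤ k → ϑ k = 0 := by
  induction m generalizing ξ with
  | zero =>
    refine ⟨0, ?_, fun _ _ => rfl⟩
    intro q
    have := h q
    simpa [expN] using this
  | succ m ih =>
    choose e he using fun q => exists_En m (ξ q) (h q)
    obtain ⟨g, hg⟩ := ev_surj (p := p) (fun q => (e q : ZMod p))
    have hg' : Good p m (fun q => ξ q / En p m (nv p g q)) := by
      intro q
      simp only
      rw [div_pow, he, En_pow_k, En_pow_k, nv_cast, hg, div_self]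
      intro h0
      have := psi_pow (p := p) (e q : ZMod p)
      rw [h0, zero_pow (NeZero.ne p)] at this
      exact zero_ne_one this
    obtain ⟨ϑ, h1, h2⟩ := ih _ hg'
    refine ⟨fun k => if k = m then g else ϑ k, ?_, ?_⟩
    · intro q
      rw [expN_succ, if_pos rfl]
      have : expN p m (fun k => if k = m then g else ϑ k) q = expN p m ϑ q := by
        unfold expN
        apply Finset.prod_congr rfl
        intro k hk
        simp only [if_neg (Finset.mem_range.mp hk).ne]
      rw [this, ← h1, div_mul_cancel₀ _ (En_ne _ _)]
    · intro k hk
      have hkm : k ≠ m := by omega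
      simp only [if_neg hkm]
      exact h2 k (by omega)

lemma expN_extend {M L : ℕ} (hL : M ≤ L) (ϑ : ℕ → ZMod p → ZMod p) (h : ∀ k, M ≤ k → ϑ k = 0)
    (q : ZMod p) : expN p M ϑ q = expN p L ϑ q := by
  unfold expN
  apply Finset.prod_subset
  · simpa using hL
  · intro k _ hk
    rw [h k (by simpa using hk), nv_zero, En_zero']

lemma exp_uniq' {M L : ℕ} (ϑ ϑ' : ℕ → ZMod p → ZMod p) (h : ∀ k, M ≤ k → ϑ k = 0)
    (h' : ∀ k, L ≤ k → ϑ' k = 0) (hh : ∀ q, expN p M ϑ q = expN p L ϑ' q) : ϑ = ϑ' := by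
  funext j
  apply expN_uniq (M + L + j + 1) ϑ ϑ' _ j (by omega)
  intro q
  rw [← expN_extend (M := M) (by omega) ϑ h, ← expN_extend (M := L) (by omega) ϑ' h', hh]

lemma expForm_eq (m : ℕ) (ϑ : Fin m → ZMod p → ZMod p) (q : ZMod p) :
    expForm p m ϑ q = expN p m (fun k => if h : k < m then ϑ ⟨k, h⟩ else 0) q := by
  unfold expForm expN
  rw [Finset.prod_range]
  apply Finset.prod_congr rfl
  intro k _
  simp only [k.2, dif_pos, En, nv]
  push_cast
  rfl

lemma coeff_eq {m M : ℕ} {ξ : ZMod p → ℂ} (hξ : Good p m ξ) (ϑ : ℕ → ZMod p → ZMod p)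
    (h : ∀ k, M ≤ k → ϑ k = 0) (hh : ∀ q, ξ q = expN p M ϑ q) (j : ℕ) (a : ZMod p) :
    coeff p m ξ j a = ϑ j a := by
  have hex : ∃ ϑ : Fin m → ZMod p → ZMod p, ∀ q, ξ q = expForm p m ϑ q := by
    obtain ⟨τ, h1, h2⟩ := exists_exp m ξ hξ
    refine ⟨fun k => τ k, fun q => ?_⟩
    rw [expForm_eq, h1]
    unfold expN
    apply Finset.prod_congr rfl
    intro k hk
    simp only [dif_pos (Finset.mem_range.mp hk)]
  have key : (fun k => if h : k < m then hex.choose ⟨k, h⟩ else 0) = ϑ := by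
    apply exp_uniq' (M := m) (L := M) _ _ _ h
    · intro q
      rw [← expForm_eq, ← hh, ← hex.choose_spec q]
    · intro k hk
      rw [dif_neg (by omega)]
  rw [← key]
  unfold coeff
  rw [dif_pos hex]
  by_cases hj : j < m <;> simp [hj]

lemma om_pow (n : ℕ) : ωp p ^ n = ZMod.stdAddChar (n : ZMod p) := by
  rw [← En_zero, ωp, En, ← Complex.exp_nat_mul]; congr 1; simp; ring

lemma Pphi_eq (m : ℕ) (ξ : ZMod p → ℂ) (q : ZMod p) :
    Pphi p m ξ q = ZMod.stdAddChar (coeff p m ξ 0 0 + coeff p m ξ 0 1 * q) := by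
  rw [Pphi, om_pow]; simp

/-- affine Pauli functions -/
def Paul (p : ℕ) [NeZero p] (u : ZMod p → ℂ) : Prop :=
  ∃ α β : ZMod p, ∀ q, u q = ZMod.stdAddChar (α + β * q)

lemma Pphi_paul (m : ℕ) (ξ : ZMod p → ℂ) : Paul p (Pphi p m ξ) := ⟨_, _, Pphi_eq m ξ⟩

lemma Pphi_mul {m : ℕ} {ξ u : ZMod p → ℂ} (hξ : Good p m ξ) (hu : Paul p u) (hu' : Good p m u) (q : ZMod p) :
    Pphi p m (fun q => u q * ξ q) q = u q * Pphi p m ξ q := by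
  obtain ⟨α, β, hab⟩ := hu
  obtain ⟨ϑ, h1, h2⟩ := exists_exp m ξ hξ
  have e1 : ∀ q, ξ q = expN p (m+1) ϑ q := fun q => by rw [h1, expN_extend (Nat.le_succ m) ϑ h2]
  have h3 : ∀ k, m + 1 ≤ k → ϑ k = 0 := fun k hk => h2 k (by omega)
  let ϑ' : ℕ → ZMod p → ZMod p := fun k => if k = 0 then ϑ 0 + (Pi.single 0 α + Pi.single 1 β) else ϑ k
  have e2 : ∀ q, u q * ξ q = expN p (m+1) ϑ' q := by
    intro q
    rw [e1, expN, expN, Finset.prod_range_succ', Finset.prod_range_succ', hab, En_zero, En_zero, nv_cast, nv_cast]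
    have : ev p (ϑ' 0) q = α + β * q + ev p (ϑ 0) q := by
      simp only [ϑ', if_pos, ev_add, ev_single, ZMod.val_zero, ZMod.val_one]; ring
    rw [this, AddChar.map_add_eq_mul _ (α + β * q)]
    simp only [ϑ', Nat.succ_ne_zero, if_false]
    generalize (ZMod.stdAddChar (α + β * q) : ℂ) = x
    ring
  have h4 : ∀ k, m + 1 ≤ k → ϑ' k = 0 := fun k hk => by
    simp only [ϑ']; rw [if_neg (by omega), h3 k hk]
  have c1 := coeff_eq hξ ϑ h3 e1
  have c2 := coeff_eq (hu'.mul hξ) ϑ' h4 e2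
  rw [Pphi_eq, Pphi_eq, c1, c1, c2, c2, hab, ← AddChar.map_add_eq_mul]
  congr 1
  simp [ϑ']
  ring

lemma dform {ξ : ZMod p → ℂ} (hc : ∃ κ, ∀ q, ξ q ^ p = κ) (hprod : ∏ q, ξ q = 1) :
    ∃ (f : ZMod p → ZMod p) (c : ZMod p), ∀ q, ξ q = ZMod.stdAddChar (ev p f q) * En p 1 c.val := by
  obtain ⟨κ, hκ⟩ := hc
  have hκp : κ ^ p = 1 := by
    have : ∏ q : ZMod p, ξ q ^ p = κ ^ p := by simp [hκ, ZMod.card]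
    rw [← this, Finset.prod_pow, hprod, one_pow]
  have hg : Good p 2 ξ := by intro q; rw [pow_two, pow_mul, hκ, hκp]
  obtain ⟨ϑ, h1, h2⟩ := exists_exp 2 ξ hg
  have h1' : ∀ q, ξ q = ZMod.stdAddChar (ev p (ϑ 0) q) * En p 1 (nv p (ϑ 1) q) := by
    intro q; rw [h1, expN_succ, expN_succ, En_zero, nv_cast]; simp [expN]
  have h3 : ∀ q, (ZMod.stdAddChar (ev p (ϑ 1) q) : ℂ) = κ := by
    intro q
    rw [← hκ q, h1', mul_pow, psi_pow, one_mul]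
    have := En_pow_k (p := p) 1 (nv p (ϑ 1) q)
    rw [pow_one] at this
    rw [this, nv_cast]
  have h4 : ϑ 1 = Pi.single 0 (ϑ 1 0) := by
    apply ev_inj'
    intro q
    have e0 : ev p (ϑ 1) 0 = ϑ 1 0 := by
      unfold ev
      rw [Finset.sum_eq_single 0]
      · simp
      · intro b _ hb
        rw [zero_pow (by simpa using hb), mul_zero]
      · simp
    rw [ev_single]
    simp only [ZMod.val_zero, pow_zero, mul_one]
    rw [← e0]
    exact psi_inj ((h3 q).trans (h3 0).symm)
  refine ⟨ϑ 0, ϑ 1 0, fun q => ?_⟩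
  rw [h1' q]
  congr 2
  conv_lhs => rw [h4]
  unfold nv
  rw [Finset.sum_eq_single 0]
  · simp
  · intro b _ hb; simp [hb]
  · simp

lemma Rphi_dform {m : ℕ} {ξ : ZMod p → ℂ} (hξ : Good p m ξ) (f : ZMod p → ZMod p) (c : ZMod p)
    (h : ∀ q, ξ q = ZMod.stdAddChar (ev p f q) * En p 1 c.val) (q : ZMod p) :
    Rphi p m ξ q = ZMod.stdAddChar (f 0 + f 1 * q) * En p 1 c.val := by
  let ϑ : ℕ → ZMod p → ZMod p := fun k => if k = 0 then f else if k = 1 then Pi.single 0 c else 0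
  have hz : ∀ k, 2 ≤ k → ϑ k = 0 := fun k hk => by
    simp only [ϑ]; rw [if_neg (by omega), if_neg (by omega)]
  have e : ∀ q, ξ q = expN p 2 ϑ q := by
    intro q
    rw [h, expN_succ, expN_succ, En_zero, nv_cast]
    have : nv p (ϑ 1) q = c.val := by
      unfold nv
      rw [Finset.sum_eq_single 0]
      · simp [ϑ]
      · intro b _ hb; simp [ϑ, hb]
      · simp
    rw [this]
    simp [expN, ϑ]
  have cc := coeff_eq hξ ϑ hz e
  rw [Rphi, Pphi_eq, cc, cc, cc]
  simp [ϑ, En, one_add_one_eq_two]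

lemma Rphi_mul {m : ℕ} {ξ η : ZMod p → ℂ} (hξ : Good p m ξ) (hη : Good p m η)
    (hc : ∃ κ, ∀ q, ξ q ^ p = κ) (hprod : ∏ q, ξ q = 1)
    (hc' : ∃ κ, ∀ q, η q ^ p = κ) (hprod' : ∏ q, η q = 1) (q : ZMod p) :
    Rphi p m (fun q => ξ q * η q) q = Rphi p m ξ q * Rphi p m η q := by
  obtain ⟨f, c, h⟩ := dform hc hprod
  obtain ⟨g, d, h'⟩ := dform hc' hprod'
  have key : En p 1 c.val * En p 1 d.val
      = ZMod.stdAddChar (((c.val + d.val) / p : ℕ) : ZMod p) * En p 1 (c + d).val := by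
    rw [← En_add, ZMod.val_add, ← En_zero, ← En_succ_mul 0, ← En_add, Nat.div_add_mod]
  set e : ZMod p := (((c.val + d.val) / p : ℕ) : ZMod p)
  rw [Rphi_dform hξ f c h, Rphi_dform hη g d h',
    Rphi_dform (hξ.mul hη) (f + g + Pi.single 0 e) (c + d)]
  · rw [mul_mul_mul_comm, key, ← mul_assoc, ← AddChar.map_add_eq_mul, ← AddChar.map_add_eq_mul]
    congr 2
    simp
    ring
  · intro q
    rw [h, h', mul_mul_mul_comm, key, ← mul_assoc, ← AddChar.map_add_eq_mul, ← AddChar.map_add_eq_mul,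
      ev_add, ev_add, ev_single]
    simp

lemma Rphi_paul {m : ℕ} {u : ZMod p → ℂ} (h : Good p m u) (hu : Paul p u) (q : ZMod p) :
    Rphi p m u q = u q := by
  obtain ⟨α, β, hab⟩ := hu
  rw [Rphi_dform h (Pi.single 0 α + Pi.single 1 β) 0]
  · rw [hab]; simp [En_zero']
  · intro q
    rw [hab, ev_add, ev_single, ev_single]; simp [En_zero', ZMod.val_one]
/-- generalised permutation matrices -/
def W (p : ℕ) (ξ : ZMod p → ℂ) (b : ZMod p) : Matrix (ZMod p) (ZMod p) ℂ :=
  Matrix.of fun i j => if i = j + b then ξ i else 0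

lemma W_apply (ξ : ZMod p → ℂ) (b i j : ZMod p) : W p ξ b i j = if i = j + b then ξ i else 0 := rfl

lemma W_mul (ξ η : ZMod p → ℂ) (b c : ZMod p) :
    W p ξ b * W p η c = W p (fun q => ξ q * η (q - b)) (b + c) := by
  ext i j
  rw [Matrix.mul_apply, Finset.sum_eq_single (i - b)]
  · simp only [W_apply, sub_add_cancel, if_true]
    by_cases h : i - b = j + c
    · rw [if_pos h, if_pos (by rw [sub_eq_iff_eq_add] at h; rw [h]; ring)]
    · rw [if_neg h, if_neg (fun h' => h (by rw [h']; ring)), mul_zero]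
  · intro k _ hk
    rw [W_apply, if_neg (fun h => hk (by rw [h]; ring)), zero_mul]
  · simp

lemma W_one : W p (fun _ => 1) 0 = 1 := by
  ext i j
  simp [W_apply, Matrix.one_apply]

lemma Xpow (n : ℕ) : Xmat p ^ n = W p (fun _ => 1) (n : ZMod p) := by
  induction n with
  | zero => simp [W_one]
  | succ n ih =>
    have : Xmat p = W p (fun _ => 1) 1 := rfl
    rw [pow_succ, ih, this, W_mul]; simp

lemma diag_eq (ξ : ZMod p → ℂ) : Matrix.diagonal ξ = W p ξ 0 := by
  ext i j
  simp [W_apply, Matrix.diagonal_apply]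

lemma diag_X (ξ : ZMod p → ℂ) (b : ZMod p) : Matrix.diagonal ξ * Xmat p ^ b.val = W p ξ b := by
  rw [Xpow, diag_eq, W_mul]; simp

lemma W_pow (ξ : ZMod p → ℂ) (b : ZMod p) (k : ℕ) :
    W p ξ b ^ k = W p (fun q => ∏ i ∈ Finset.range k, ξ (q - i * b)) (k * b) := by
  induction k with
  | zero => simp [W_one]
  | succ k ih =>
    rw [pow_succ, ih, W_mul]
    congr 1
    · funext q; rw [Finset.prod_range_succ]
    · push_cast; ring

lemma W_inj {ξ η : ZMod p → ℂ} {b c : ZMod p} (hξ : ∀ q, ξ q ≠ 0) (h : W p ξ b = W p η c) :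
    b = c ∧ ξ = η := by
  have hb : b = c := by
    by_contra hbc
    have := congrFun (congrFun h b) 0
    rw [W_apply, W_apply, if_pos (by simp), if_neg (by simpa using hbc)] at this
    exact hξ _ this
  refine ⟨hb, funext fun q => ?_⟩
  subst hb
  have := congrFun (congrFun h q) (q - b)
  simpa [W_apply] using this

lemma prod_range_zmod (F : ZMod p → ℂ) : ∏ i ∈ Finset.range p, F (i : ZMod p) = ∏ x : ZMod p, F x := by
  refine Finset.prod_bij (fun i _ => (i : ZMod p)) (fun _ _ => Finset.mem_univ _) ?_ ?_ (fun _ _ => rfl)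
  · intro a ha b hb hab
    have := (ZMod.natCast_eq_natCast_iff' a b p).mp hab
    rwa [Nat.mod_eq_of_lt (Finset.mem_range.mp ha), Nat.mod_eq_of_lt (Finset.mem_range.mp hb)] at this
  · intro x _
    exact ⟨x.val, Finset.mem_range.mpr (ZMod.val_lt x), by simp⟩

lemma W_tor (ξ : ZMod p → ℂ) {b : ZMod p} (hb : b ≠ 0) (h : ∏ q, ξ q = 1) : W p ξ b ^ p = 1 := by
  rw [W_pow, ← W_one]
  congr 1
  · funext q
    rw [prod_range_zmod (fun i => ξ (q - i * b)), ← h]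
    apply Fintype.prod_bijective (fun x => q - x * b) _ _ _ (fun _ => rfl)
    apply Finite.injective_iff_bijective.mp
    intro x y hxy
    simpa [hb] using hxy
  · simp

lemma phi1_zero (m : ℕ) {ξ : ZMod p → ℂ} (hξ : ∀ q, ξ q ≠ 0) :
    phi1 p m (W p ξ 0) = W p (Rphi p m ξ) 0 := by
  unfold phi1
  rw [dif_neg, diag_eq]
  · simp [W_apply]
  · rintro ⟨b, hb, η, h⟩
    rw [diag_X] at h
    exact hb (W_inj hξ h).1.symm

lemma phi1_ne (m : ℕ) {ξ η : ZMod p → ℂ} {b : ZMod p} (hb : b ≠ 0) (hξ : ∀ q, ξ q ≠ 0)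
    (h : W p ξ b ^ (b⁻¹).val = W p η 1) :
    phi1 p m (W p ξ b) = W p (Pphi p m η) 1 ^ b.val := by
  have hex : ∃ c : ZMod p, c ≠ 0 ∧ ∃ ζ : ZMod p → ℂ, W p ξ b = Matrix.diagonal ζ * Xmat p ^ c.val :=
    ⟨b, hb, ξ, (diag_X ξ b).symm⟩
  have hch : hex.choose = b := by
    obtain ⟨_, ζ, h2⟩ := hex.choose_spec
    rw [diag_X] at h2
    exact (W_inj hξ h2).1.symm
  unfold phi1
  rw [dif_pos hex, hch, h]
  have : Xmat p = W p (fun _ => 1) 1 := rfl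
  rw [this, diag_eq, W_mul]
  simp [W_apply]

lemma Good.shift {m : ℕ} {ξ : ZMod p → ℂ} (h : Good p m ξ) (s : ZMod p) :
    Good p m (fun q => ξ (q - s)) := fun q => h _

lemma Paul.mul {u v : ZMod p → ℂ} (hu : Paul p u) (hv : Paul p v) : Paul p (fun q => u q * v q) := by
  obtain ⟨a, b, h⟩ := hu
  obtain ⟨c, d, h'⟩ := hv
  refine ⟨a + c, b + d, fun q => ?_⟩
  simp only [h, h']; rw [← AddChar.map_add_eq_mul]; congr 1; ring

lemma Paul.shift {u : ZMod p → ℂ} (hu : Paul p u) (s : ZMod p) : Paul p (fun q => u (q - s)) := by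
  obtain ⟨a, b, h⟩ := hu
  refine ⟨a - b * s, b, fun q => ?_⟩
  simp only [h]; congr 1; ring

lemma Paul.ne {u : ZMod p → ℂ} (hu : Paul p u) (q : ZMod p) : u q ≠ 0 := by
  obtain ⟨a, b, h⟩ := hu
  intro h0
  have := psi_pow (a + b * q)
  rw [← h, h0, zero_pow (NeZero.ne p)] at this
  exact zero_ne_one this

lemma sum_zmod (hodd : Odd p) : ∑ q : ZMod p, q = 0 := by
  have h : ∑ q : ZMod p, q = ∑ q : ZMod p, -q :=
    (Equiv.sum_comp (Equiv.neg (ZMod p)) (fun q => q)).symm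
  rw [Finset.sum_neg_distrib] at h
  have h2 : (2 : ZMod p) * ∑ q : ZMod p, q = 0 := by
    rw [two_mul]; nth_rewrite 1 [h]; simp
  rcases mul_eq_zero.mp h2 with h3 | h3
  · exfalso
    have : ((2 : ℕ) : ZMod p) = 0 := by exact_mod_cast h3
    rw [ZMod.natCast_eq_zero_iff] at this
    have h4 := (Nat.prime_dvd_prime_iff_eq hp.out Nat.prime_two).mp this
    subst h4
    exact absurd hodd (by decide)
  · exact h3

lemma Paul.prod (hodd : Odd p) {u : ZMod p → ℂ} (hu : Paul p u) : ∏ q, u q = 1 := by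
  obtain ⟨a, b, h⟩ := hu
  simp only [h]
  have : ∀ s : Finset (ZMod p), (ZMod.stdAddChar (∑ q ∈ s, (a + b * q)) : ℂ)
      = ∏ q ∈ s, ZMod.stdAddChar (a + b * q) := by
    intro s
    induction s using Finset.induction_on with
    | empty => simp
    | insert x s hx ih => rw [Finset.sum_insert hx, Finset.prod_insert hx, AddChar.map_add_eq_mul, ih]
  rw [← this]
  rw [Finset.sum_add_distrib, ← Finset.mul_sum, sum_zmod hodd]
  simp

lemma W_comm_pow (β u : ZMod p → ℂ) (j : ℕ) :
    W p β 1 ^ j * W p u 0 = W p (fun q => u (q - j)) 0 * W p β 1 ^ j := by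
  rw [W_pow, W_mul, W_mul]
  simp [mul_comm]

lemma pow_DA (m : ℕ) {u : ZMod p → ℂ} (hu : Paul p u) (hu' : Good p m u) (j k : ℕ) :
    ∃ v, Paul p v ∧ Good p m v ∧ ∀ β, (W p u 0 * W p β 1 ^ j) ^ k = W p v 0 * W p β 1 ^ (j * k) := by
  induction k with
  | zero =>
    refine ⟨fun _ => 1, ⟨0, 0, by simp⟩, fun q => one_pow _, fun β => ?_⟩
    simp [W_one]
  | succ k ih =>
    obtain ⟨v, h1, h2, h3⟩ := ih
    refine ⟨fun q => u q * v (q - j), hu.mul (h1.shift _), hu'.mul (h2.shift _), fun β => ?_⟩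
    rw [pow_succ', h3, mul_assoc, ← mul_assoc (W p β 1 ^ j), W_comm_pow, mul_assoc, ← pow_add,
      ← mul_assoc, W_mul]
    congr 2
    · simp
    · simp
    · ring

lemma pow_mod_of {M : Type*} [Monoid M] {x : M} (h : x ^ p = 1) {i j : ℕ}
    (hij : (i : ZMod p) = j) : x ^ i = x ^ j :=
  pow_eq_pow_of_modEq ((ZMod.natCast_eq_natCast_iff _ _ _).mp hij) h

lemma Good.prodR {m : ℕ} {ξ : ZMod p → ℂ} (h : Good p m ξ) (k : ℕ) (b : ZMod p) :
    Good p m (fun q => ∏ i ∈ Finset.range k, ξ (q - i * b)) := by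
  intro q
  simp only
  rw [← Finset.prod_pow]
  exact Finset.prod_eq_one fun i _ => h _

lemma Paul.prodR {ξ : ZMod p → ℂ} (h : Paul p ξ) (k : ℕ) (b : ZMod p) :
    Paul p (fun q => ∏ i ∈ Finset.range k, ξ (q - i * b)) := by
  induction k with
  | zero => exact ⟨0, 0, by simp⟩
  | succ k ih =>
    simp only [Finset.prod_range_succ]
    exact ih.mul (h.shift _)

lemma phi1_DA (hodd : Odd p) (m : ℕ) {η u : ZMod p → ℂ} (hη : Good p m η) (hη1 : ∏ q, η q = 1)
    (hu : Paul p u) (hu' : Good p m u) (j : ℕ) :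
    phi1 p m (W p u 0 * W p η 1 ^ j) = W p u 0 * W p (Pphi p m η) 1 ^ j := by
  have hA : W p η 1 ^ p = 1 := W_tor η one_ne_zero hη1
  have hN : W p (Pphi p m η) 1 ^ p = 1 := W_tor _ one_ne_zero ((Pphi_paul m η).prod hodd)
  by_cases hj : (j : ZMod p) = 0
  · have hj' : (j : ZMod p) = (0 : ℕ) := by simpa using hj
    rw [pow_mod_of hA hj', pow_mod_of hN hj', pow_zero, pow_zero, mul_one, phi1_zero m hu.ne]
    congr 1
    funext q
    exact Rphi_paul hu' hu q
  · have hinv : ((j * ((j : ZMod p)⁻¹).val : ℕ) : ZMod p) = (1 : ℕ) := by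
      push_cast
      rw [ZMod.natCast_zmod_val, mul_inv_cancel₀ hj]
    obtain ⟨v, h1, h2, h3⟩ := pow_DA m hu hu' j ((j : ZMod p)⁻¹).val
    have eA := h3 η
    have eN := h3 (Pphi p m η)
    rw [pow_mod_of hA hinv, pow_one, W_mul] at eA
    rw [pow_mod_of hN hinv, pow_one, W_mul] at eN
    simp only [zero_add, sub_zero] at eA eN
    have f1 : ∀ β, W p u 0 * W p β 1 ^ j
        = W p (fun q => u q * ∏ i ∈ Finset.range j, β (q - i * 1)) j := by
      intro β; rw [W_pow, W_mul]; simp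
    rw [f1 η] at eA ⊢
    rw [phi1_ne m hj (fun q => (hu'.mul (hη.prodR j 1)).ne q) eA]
    have : Pphi p m (fun q => v q * η q) = fun q => v q * Pphi p m η q :=
      funext fun q => Pphi_mul hη h1 h2 q
    rw [this, ← eN, ← pow_mul]
    have hT : (W p u 0 * W p (Pphi p m η) 1 ^ j) ^ p = 1 := by
      rw [f1]
      exact W_tor _ hj ((hu.mul ((Pphi_paul m η).prodR j 1)).prod hodd)
    have hinv2 : ((((j : ZMod p)⁻¹).val * (j : ZMod p).val : ℕ) : ZMod p) = (1 : ℕ) := by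
      push_cast
      rw [ZMod.natCast_zmod_val, ZMod.natCast_zmod_val, inv_mul_cancel₀ hj]
    rw [pow_mod_of hT hinv2, pow_one]

lemma core (hodd : Odd p) (m : ℕ) {η u v : ZMod p → ℂ} (hη : Good p m η) (hη1 : ∏ q, η q = 1)
    (hu : Paul p u) (hu' : Good p m u) (hv : Paul p v) (hv' : Good p m v) (i j : ℕ) :
    phi1 p m ((W p u 0 * W p η 1 ^ i) * (W p v 0 * W p η 1 ^ j))
      = phi1 p m (W p u 0 * W p η 1 ^ i) * phi1 p m (W p v 0 * W p η 1 ^ j) := by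
  have key : ∀ β, (W p u 0 * W p β 1 ^ i) * (W p v 0 * W p β 1 ^ j)
      = W p (fun q => u q * v (q - i)) 0 * W p β 1 ^ (i + j) := by
    intro β
    rw [mul_assoc, ← mul_assoc (W p β 1 ^ i), W_comm_pow, mul_assoc, ← pow_add, ← mul_assoc, W_mul]
    simp
  rw [key, phi1_DA hodd m hη hη1 (hu.mul (hv.shift _)) (hu'.mul (hv'.shift _)),
    phi1_DA hodd m hη hη1 hu hu', phi1_DA hodd m hη hη1 hv hv', key]

lemma decomp (hodd : Odd p) (m : ℕ) {η ξ : ZMod p → ℂ} {b : ZMod p} (hη : Good p m η)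
    (hη1 : ∏ q, η q = 1) (hξ : Good p m ξ) (hξ1 : ∏ q, ξ q = 1) (c : ℂ)
    (hc : W p ξ b * W p η 1 = c • (W p η 1 * W p ξ b)) :
    ∃ u, Paul p u ∧ Good p m u ∧ W p ξ b = W p u 0 * W p η 1 ^ b.val := by
  have hα := hη.prodR b.val 1
  have hα1 : ∏ q, (∏ i ∈ Finset.range b.val, η (q - i * 1)) = 1 := by
    rw [Finset.prod_comm]
    apply Finset.prod_eq_one
    intro i _
    rw [← hη1]
    exact Equiv.prod_comp (Equiv.subRight (i * 1 : ZMod p)) η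
  have hApow := W_pow η 1 b.val
  simp only [ZMod.natCast_val, ZMod.cast_id', id, mul_one] at hApow hα hα1
  set α : ZMod p → ℂ := fun q => ∏ i ∈ Finset.range b.val, η (q - i) with hαdef
  have hu' : Good p m (fun q => ξ q / α q) := by
    intro q; simp only; rw [div_pow, hξ, hα, div_one]
  have hdec : W p ξ b = W p (fun q => ξ q / α q) 0 * W p η 1 ^ b.val := by
    rw [hApow, W_mul]
    simp only [sub_zero, zero_add]
    congr 1
    funext q
    exact (div_mul_cancel₀ _ (hα.ne q)).symm
  have hprod : ∏ q, (ξ q / α q) = 1 := by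
    rw [Finset.prod_div_distrib, hξ1, hα1, div_one]
  refine ⟨_, ?_, hu', hdec⟩
  have hA : W p η 1 ^ p = 1 := W_tor η one_ne_zero hη1
  set u : ZMod p → ℂ := fun q => ξ q / α q with hudef
  have hAinv : W p η 1 ^ b.val * W p η 1 ^ ((p - 1) * b.val) = 1 := by
    rw [← pow_add, show b.val + (p-1) * b.val = p * b.val by
      have := hp.out.pos
      obtain ⟨r, rfl⟩ := Nat.exists_eq_succ_of_ne_zero this.ne'
      simp; ring, pow_mul, hA, one_pow]
  have hDA : W p u 0 * W p η 1 = c • (W p η 1 * W p u 0) := by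
    have h1 := congrArg (· * W p η 1 ^ ((p - 1) * b.val)) hc
    simp only [hdec] at h1
    rw [mul_assoc (W p u 0), ← pow_succ, pow_succ', ← mul_assoc, ← mul_assoc, smul_mul_assoc, mul_assoc,
      hAinv, mul_assoc _ _ (W p η 1 ^ ((p - 1) * b.val)), hAinv, mul_one, mul_one] at h1
    exact h1
  have hrec : ∀ q, u q = c * u (q - 1) := by
    intro q
    rw [W_mul, W_mul] at hDA
    have := congrFun (congrFun hDA q) (q - 1)
    simp [W_apply] at this
    have h2 : η q * u q = η q * (c * u (q - 1)) := by rw [mul_comm, this]; ring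
    exact mul_left_cancel₀ (hη.ne q) h2
  have hn : ∀ n : ℕ, u n = c ^ n * u 0 := by
    intro n
    induction n with
    | zero => simp
    | succ n ih => rw [hrec]; push_cast; rw [add_sub_cancel_right, ih]; ring
  have hcp : c ^ p = 1 := by
    have := hn p
    rw [CharP.cast_eq_zero] at this
    exact mul_right_cancel₀ (hu'.ne 0) (by rw [one_mul]; exact this.symm)
  obtain ⟨β, hβ⟩ := exists_psi c hcp
  have hq : ∀ q, u q = ZMod.stdAddChar (β * q) * u 0 := by
    intro q
    have := hn q.val
    rw [ZMod.natCast_zmod_val] at this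
    rw [this, hβ, ← AddChar.map_nsmul_eq_pow, nsmul_eq_mul, ZMod.natCast_zmod_val, mul_comm q]
  have h0 : u 0 ^ p = 1 := by
    have h1 : ∏ q, u q = 1 := hprod
    rw [Finset.prod_congr rfl (fun q _ => hq q)] at h1
    rw [Finset.prod_mul_distrib,
      Paul.prod hodd (u := fun q => ZMod.stdAddChar (β * q)) ⟨0, β, by simp⟩] at h1
    simpa [ZMod.card] using h1
  obtain ⟨a, ha⟩ := exists_psi _ h0
  refine ⟨a, β, fun q => ?_⟩
  rw [hq, ha, ← AddChar.map_add_eq_mul, add_comm]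

lemma comm_pow_smul {c : ℂ} {M M' : Matrix (ZMod p) (ZMod p) ℂ} (h : M' * M = c • (M * M')) (k : ℕ) :
    M' * M ^ k = c ^ k • (M ^ k * M') := by
  induction k with
  | zero => simp
  | succ k ih =>
    rw [pow_succ, ← mul_assoc, ih, smul_mul_assoc, mul_assoc, h, mul_smul_comm, smul_smul, ← mul_assoc, pow_succ]

lemma root_A (m : ℕ) {ξ : ZMod p → ℂ} {b : ZMod p} (hξ : Good p m ξ)
    (hξ1 : ∏ q, ξ q = 1) (hb : b ≠ 0) :
    ∃ η, Good p m η ∧ ∏ q, η q = 1 ∧ W p ξ b ^ (b⁻¹).val = W p η 1 := by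
  refine ⟨_, hξ.prodR (b⁻¹).val b, ?_, ?_⟩
  · rw [Finset.prod_comm]
    apply Finset.prod_eq_one
    intro i _
    rw [← hξ1]
    exact Equiv.prod_comp (Equiv.subRight (i * b : ZMod p)) ξ
  · rw [W_pow, ZMod.natCast_zmod_val, inv_mul_cancel₀ hb]

lemma component (hodd : Odd p) (m : ℕ) {ξ ξ' : ZMod p → ℂ} {b b' : ZMod p}
    (hξ : Good p m ξ) (hξ1 : ∏ q, ξ q = 1) (hξ' : Good p m ξ') (hξ1' : ∏ q, ξ' q = 1)
    (ht : b = 0 → ∃ κ, ∀ q, ξ q ^ p = κ) (ht' : b' = 0 → ∃ κ, ∀ q, ξ' q ^ p = κ)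
    (c : ℂ) (hc0 : c ≠ 0) (hc : W p ξ b * W p ξ' b' = c • (W p ξ' b' * W p ξ b)) :
    phi1 p m (W p ξ b * W p ξ' b') = phi1 p m (W p ξ b) * phi1 p m (W p ξ' b') := by
  have fin : ∀ η, Good p m η → ∏ q, η q = 1 →
      (∃ c : ℂ, W p ξ b * W p η 1 = c • (W p η 1 * W p ξ b)) →
      (∃ c : ℂ, W p ξ' b' * W p η 1 = c • (W p η 1 * W p ξ' b')) →
      phi1 p m (W p ξ b * W p ξ' b') = phi1 p m (W p ξ b) * phi1 p m (W p ξ' b') := by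
    rintro η h1 h2 ⟨c1, h3⟩ ⟨c2, h4⟩
    obtain ⟨u, hu, hu', e⟩ := decomp hodd m h1 h2 hξ hξ1 c1 h3
    obtain ⟨v, hv, hv', e'⟩ := decomp hodd m h1 h2 hξ' hξ1' c2 h4
    rw [e, e']
    exact core hodd m h1 h2 hu hu' hv hv' _ _
  by_cases hb : b = 0
  · by_cases hb' : b' = 0
    · subst hb hb'
      rw [W_mul]
      simp only [sub_zero, add_zero]
      rw [phi1_zero m hξ.ne, phi1_zero m hξ'.ne, phi1_zero m (hξ.mul hξ').ne, W_mul]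
      simp only [sub_zero, add_zero]
      congr 1
      funext q
      exact Rphi_mul hξ hξ' (ht rfl) hξ1 (ht' rfl) hξ1' q
    · obtain ⟨η, h1, h2, h3⟩ := root_A m hξ' hξ1' hb'
      apply fin η h1 h2
      · exact ⟨_, by rw [← h3]; exact comm_pow_smul hc _⟩
      · exact ⟨1, by rw [← h3, one_smul, ← pow_succ, ← pow_succ']⟩
  · obtain ⟨η, h1, h2, h3⟩ := root_A m hξ hξ1 hb
    apply fin η h1 h2
    · exact ⟨1, by rw [← h3, one_smul, ← pow_succ, ← pow_succ']⟩
    · refine ⟨c⁻¹ ^ (b⁻¹).val, ?_⟩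
      rw [← h3]
      apply comm_pow_smul
      rw [hc, smul_smul, inv_mul_cancel₀ hc0, one_smul]

lemma kron_mul (n : ℕ) (A B : Fin n → Matrix (ZMod p) (ZMod p) ℂ) :
    kron p n A * kron p n B = kron p n (fun i => A i * B i) := by
  ext f g
  simp only [kron, Matrix.mul_apply, Matrix.of_apply]
  rw [Finset.prod_univ_sum, Fintype.piFinset_univ]
  apply Finset.sum_congr rfl
  intro h _
  rw [Finset.prod_mul_distrib]

lemma kron_one (n : ℕ) : kron p n (fun _ => 1) = 1 := by
  ext f g
  simp only [kron, Matrix.of_apply, Matrix.one_apply]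
  by_cases h : f = g
  · simp [h]
  · rw [if_neg h]
    obtain ⟨i, hi⟩ := Function.ne_iff.mp h
    exact Finset.prod_eq_zero (Finset.mem_univ i) (if_neg hi)

lemma kron_pow (n : ℕ) (A : Fin n → Matrix (ZMod p) (ZMod p) ℂ) (k : ℕ) :
    kron p n A ^ k = kron p n (fun i => A i ^ k) := by
  induction k with
  | zero => simp [kron_one]
  | succ k ih => rw [pow_succ, ih, kron_mul]; simp [pow_succ]

lemma kron_W {n : ℕ} {α β : Fin n → ZMod p → ℂ} {s : Fin n → ZMod p}
    (hα : ∀ i q, α i q ≠ 0) (hβ : ∀ i q, β i q ≠ 0)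
    (h : kron p n (fun i => W p (α i) (s i)) = kron p n (fun i => W p (β i) (s i))) (i : Fin n) (q : ZMod p) :
    α i q = (α i 0 / β i 0) * β i q := by
  have h1 : ∀ f : Fin n → ZMod p, ∏ i, (α i (f i) / β i (f i)) = 1 := by
    intro f
    have := congrFun (congrFun h f) (fun i => f i - s i)
    simp only [kron, Matrix.of_apply, W_apply, sub_add_cancel, if_true] at this
    rw [Finset.prod_div_distrib, this, div_self]
    exact Finset.prod_ne_zero_iff.mpr fun i _ => hβ i _
  have h2 := h1 (fun _ => 0)
  have h3 := h1 (Function.update (fun _ => 0) i q)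
  rw [← Finset.mul_prod_erase _ _ (Finset.mem_univ i)] at h2 h3
  have h4 : ∏ x ∈ Finset.univ.erase i, (α x (Function.update (fun _ => (0 : ZMod p)) i q x) /
      β x (Function.update (fun _ => (0 : ZMod p)) i q x))
      = ∏ x ∈ Finset.univ.erase i, (α x 0 / β x 0) := by
    apply Finset.prod_congr rfl
    intro x hx
    rw [Function.update_of_ne (Finset.ne_of_mem_erase hx)]
  rw [h4, Function.update_self, ← h2] at h3
  have h5 := mul_right_cancel₀ (by
    intro h0; rw [h0, mul_zero] at h2; exact zero_ne_one h2) h3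
  rw [← h5, div_mul_cancel₀ _ (hβ i q)]

end lemmas

/-- Let `p` be an odd prime.  The map `φ : K_Q(p)^{⊗n}_{(p)} → H(ℤ_p)^{⊗n}`, defined
component-wise by `φ₁`, restricts to a group homomorphism on every `p`-torsion abelian
subgroup: for all `p`-torsion `M, M' ∈ K_Q(p)^{⊗n}` with `[M, M'] = 𝟙`,
`φ(M M') = φ(M) φ(M')`. -/
theorem stmt_15 (p m n : ℕ) [NeZero p] (hp : Nat.Prime p) (hodd : Odd p)
    (Ms Ms' : Fin n → Matrix (ZMod p) (ZMod p) ℂ)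
    (hmem : ∀ i, ∃ ξ : ZMod p → ℂ, (∀ q, ξ q ^ p ^ m = 1) ∧ (∏ q : ZMod p, ξ q = 1) ∧
      ∃ b : ZMod p, Ms i = Matrix.diagonal ξ * Xmat p ^ b.val)
    (hmem' : ∀ i, ∃ ξ : ZMod p → ℂ, (∀ q, ξ q ^ p ^ m = 1) ∧ (∏ q : ZMod p, ξ q = 1) ∧
      ∃ b : ZMod p, Ms' i = Matrix.diagonal ξ * Xmat p ^ b.val)
    (htor : (kron p n Ms) ^ p = 1) (htor' : (kron p n Ms') ^ p = 1)
    (hcomm : kron p n Ms * kron p n Ms' = kron p n Ms' * kron p n Ms) :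
    kron p n (fun i => phi1 p m (Ms i * Ms' i)) =
      kron p n (fun i => phi1 p m (Ms i)) * kron p n (fun i => phi1 p m (Ms' i)) := by
  have : Fact p.Prime := ⟨hp⟩
  choose ξ hξ hξ1 b hM using hmem
  choose ξ' hξ' hξ1' b' hM' using hmem'
  have eM : Ms = fun i => W p (ξ i) (b i) := funext fun i => by rw [hM, diag_X]
  have eM' : Ms' = fun i => W p (ξ' i) (b' i) := funext fun i => by rw [hM', diag_X]
  subst eM eM'
  have tor : ∀ (ζ : Fin n → ZMod p → ℂ) (d : Fin n → ZMod p), (∀ i, Good p m (ζ i)) →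
      kron p n (fun i => W p (ζ i) (d i)) ^ p = 1 → ∀ i, d i = 0 → ∃ κ, ∀ q, ζ i q ^ p = κ := by
    intro ζ d hζ h i hi
    rw [kron_pow, ← kron_one] at h
    simp only [W_pow, ← W_one, CharP.cast_eq_zero, zero_mul] at h
    have := kron_W (s := fun _ => 0) (β := fun _ _ => 1)
      (fun i q => ((hζ i).prodR p (d i)).ne q) (fun _ _ => one_ne_zero) h i
    simp only [hi, mul_zero, sub_zero, Finset.prod_const, Finset.card_range] at this
    exact ⟨_, this⟩
  rw [kron_mul]
  congr 1
  funext i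
  have hne := fun i q => Good.ne (hξ i) q
  have hne' := fun i q => Good.ne (hξ' i) q
  rw [kron_mul, kron_mul] at hcomm
  simp only [W_mul] at hcomm
  have e : ∀ i, b' i + b i = b i + b' i := fun i => add_comm _ _
  simp only [e] at hcomm
  have hk := kron_W (s := fun i => b i + b' i)
    (fun i q => mul_ne_zero (hne i q) (hne' i (q - b i)))
    (fun i q => mul_ne_zero (hne' i q) (hne i (q - b' i))) hcomm i
  refine component hodd m (hξ i) (hξ1 i) (hξ' i) (hξ1' i) (tor ξ b hξ htor i) (tor ξ' b' hξ' htor' i)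
    ((ξ i 0 * ξ' i (0 - b i)) / (ξ' i 0 * ξ i (0 - b' i))) ?_ ?_
  · exact div_ne_zero (mul_ne_zero (hne _ _) (hne' _ _)) (mul_ne_zero (hne' _ _) (hne _ _))
  · rw [W_mul, W_mul, e]
    ext x y
    simp only [W_apply, Matrix.smul_apply, smul_eq_mul]
    split_ifs
    · exact hk x
    · simp
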